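/- arXiv:math/0703054 — 5 statements merged into one kernel-verified Lean document; each statement's English description precedes it below -/
import Mathlib

section
/- Let 0 < H < 1/2 and d ∈ ℝ. Set c₁ = (2dH + √(1 − 4H² + d²))/(1 − 4H²) and ρ₁ = arcosh c₁, and define λ(ρ) = ∫_{ρ₁}^{ρ} (d + 2H cosh r)/√(sinh²r − (d + 2H cosh r)²) dr. Then the integrand is integrable on [ρ₁, ρ] for every ρ > ρ₁, and λ(ρ) → +∞ as ρ → +∞. -/
noncomputable def arcosh (x : ℝ) : ℝ := Real.log (x + Real.sqrt (x^2 - 1))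

theorem sq_sub_one_sub_sq_factorization {H : ℝ} (d : ℝ) (hH0 : 0 < H) (hH : H < 1/2) :
    1 ≤ (2*d*H + Real.sqrt (1 - 4*H^2 + d^2))/(1 - 4*H^2) ∧
    ∃ c₂ ≤ 0, ∀ x : ℝ, x^2 - 1 - (d + 2*H*x)^2 =
      (1 - 4*H^2) * (x - (2*d*H + Real.sqrt (1 - 4*H^2 + d^2))/(1 - 4*H^2)) * (x - c₂) := by
  have ha : 0 < 1 - 4*H^2 := by nlinarith
  have hS : Real.sqrt (1 - 4*H^2 + d^2) ^ 2 = 1 - 4*H^2 + d^2 :=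
    Real.sq_sqrt (by positivity)
  have h1 : 1 - 4*H^2 - 2*d*H ≤ Real.sqrt (1 - 4*H^2 + d^2) := by
    apply Real.le_sqrt_of_sq_le
    nlinarith [mul_nonneg ha.le (sq_nonneg (2*H + d))]
  have h2 : 2*d*H ≤ Real.sqrt (1 - 4*H^2 + d^2) := by
    apply Real.le_sqrt_of_sq_le
    nlinarith [mul_nonneg ha.le (sq_nonneg d)]
  refine ⟨by rw [le_div_iff₀ ha]; linarith,
    (2*d*H - Real.sqrt (1 - 4*H^2 + d^2))/(1 - 4*H^2),
    div_nonpos_of_nonpos_of_nonneg (by linarith) ha.le, fun x => ?_⟩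
  generalize Real.sqrt (1 - 4*H^2 + d^2) = S at *
  generalize ha_eq : 1 - 4*H^2 = a at *
  field_simp
  linear_combination hS + (a*x^2 + d^2) * ha_eq

theorem sinh_mul_sub_le_cosh_sub_cosh {x y : ℝ} (hxy : x ≤ y) :
    Real.sinh x * (y - x) ≤ Real.cosh y - Real.cosh x := by
  refine Convex.mul_sub_le_image_sub_of_le_deriv (convex_Ici x) Real.continuous_cosh.continuousOn
    Real.differentiable_cosh.differentiableOn (fun z hz => ?_) x Set.self_mem_Ici y hxy hxy
  rw [interior_Ici] at hz
  rw [Real.deriv_cosh]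
  exact Real.sinh_le_sinh.2 (le_of_lt hz)

/-- The profile slope has at worst an inverse square root singularity at the base point. -/
theorem abs_slope_le {H d c₂ ρ₀ r : ℝ} (hH0 : 0 < H) (hH : H < 1/2) (hρ : 0 ≤ ρ₀) (hc₂ : c₂ ≤ 0)
    (hf : ∀ x : ℝ, x^2 - 1 - (d + 2*H*x)^2 = (1 - 4*H^2) * (x - Real.cosh ρ₀) * (x - c₂))
    (hr : ρ₀ < r) :
    |(d + 2*H*Real.cosh r) / Real.sqrt (Real.sinh r ^ 2 - (d + 2*H*Real.cosh r)^2)| ≤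
      (Real.sqrt (Real.sinh ρ₀) * (r - ρ₀) ^ (-(1/2) : ℝ)
        + 2*H*Real.sqrt (Real.cosh r - Real.cosh ρ₀)) / Real.sqrt (1 - 4*H^2) := by
  have ha : 0 < 1 - 4*H^2 := by nlinarith
  have hs : 0 ≤ Real.sinh ρ₀ := Real.sinh_nonneg_iff.2 hρ
  have hu : 0 < Real.cosh r - Real.cosh ρ₀ := by
    have := Real.cosh_lt_cosh.2 (by rwa [abs_of_nonneg hρ, abs_of_pos (by linarith)] : |ρ₀| < |r|)
    linarith
  have hbase : |d + 2*H*Real.cosh ρ₀| = Real.sinh ρ₀ := by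
    rw [← abs_of_nonneg hs, ← sq_eq_sq_iff_abs_eq_abs]
    have := hf (Real.cosh ρ₀)
    rw [Real.sinh_sq]
    linarith [show (1 - 4*H^2) * (Real.cosh ρ₀ - Real.cosh ρ₀) * (Real.cosh ρ₀ - c₂) = 0 by ring]
  have hnum : |d + 2*H*Real.cosh r| ≤
      Real.sinh ρ₀ + 2*H*(Real.cosh r - Real.cosh ρ₀) := by
    calc |d + 2*H*Real.cosh r|
        = |(d + 2*H*Real.cosh ρ₀) + 2*H*(Real.cosh r - Real.cosh ρ₀)| := by ring_nf
      _ ≤ _ := (abs_add_le _ _).trans (by rw [hbase, abs_of_pos (a := 2*H*_) (by positivity)])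
  have hden : (1 - 4*H^2) * (Real.cosh r - Real.cosh ρ₀) ≤
      Real.sinh r ^ 2 - (d + 2*H*Real.cosh r)^2 := by
    rw [Real.sinh_sq, hf]
    exact le_mul_of_one_le_right (by positivity) (by linarith [Real.one_le_cosh r])
  have hroot : 0 < Real.sqrt (Real.cosh r - Real.cosh ρ₀) := Real.sqrt_pos.2 hu
  have hsing : Real.sinh ρ₀ / Real.sqrt (Real.cosh r - Real.cosh ρ₀) ≤
      Real.sqrt (Real.sinh ρ₀) * (r - ρ₀) ^ (-(1/2) : ℝ) := by
    have hr' : 0 < Real.sqrt (r - ρ₀) := Real.sqrt_pos.2 (by linarith)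
    rw [Real.rpow_neg (by linarith), ← Real.sqrt_eq_rpow, ← div_eq_mul_inv,
      div_le_div_iff₀ hroot hr']
    have := Real.sqrt_le_sqrt (sinh_mul_sub_le_cosh_sub_cosh hr.le)
    rw [Real.sqrt_mul hs] at this
    calc Real.sinh ρ₀ * Real.sqrt (r - ρ₀)
        = Real.sqrt (Real.sinh ρ₀) * (Real.sqrt (Real.sinh ρ₀) * Real.sqrt (r - ρ₀)) := by
          rw [← mul_assoc, Real.mul_self_sqrt hs]
      _ ≤ _ := by gcongr
  rw [abs_div, abs_of_nonneg (Real.sqrt_nonneg _)]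
  calc _ ≤ (Real.sinh ρ₀ + 2*H*(Real.cosh r - Real.cosh ρ₀)) /
        Real.sqrt ((1 - 4*H^2) * (Real.cosh r - Real.cosh ρ₀)) := by gcongr
    _ = (Real.sinh ρ₀ / Real.sqrt (Real.cosh r - Real.cosh ρ₀)
        + 2*H*Real.sqrt (Real.cosh r - Real.cosh ρ₀)) / Real.sqrt (1 - 4*H^2) := by
      rw [Real.sqrt_mul ha.le]
      have hsq := Real.sq_sqrt hu.le
      field_simp
      rw [hsq]
    _ ≤ _ := by gcongr

theorem intervalIntegrable_slope {H d c₂ ρ₀ ρ : ℝ} (hH0 : 0 < H) (hH : H < 1/2) (hρ₀ : 0 ≤ ρ₀)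
    (hc₂ : c₂ ≤ 0)
    (hf : ∀ x : ℝ, x^2 - 1 - (d + 2*H*x)^2 = (1 - 4*H^2) * (x - Real.cosh ρ₀) * (x - c₂))
    (hρ : ρ₀ ≤ ρ) :
    IntervalIntegrable
      (fun r => (d + 2*H*Real.cosh r) / Real.sqrt (Real.sinh r ^ 2 - (d + 2*H*Real.cosh r)^2))
      MeasureTheory.volume ρ₀ ρ := by
  have hpow : IntervalIntegrable (fun r : ℝ => (r - ρ₀) ^ (-(1/2) : ℝ))
      MeasureTheory.volume ρ₀ ρ := by
    simpa using (intervalIntegral.intervalIntegrable_rpow' (a := 0) (b := ρ - ρ₀)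
      (by norm_num : (-1 : ℝ) < -(1/2))).comp_sub_right ρ₀
  have hroot : IntervalIntegrable
      (fun r : ℝ => 2*H*Real.sqrt (Real.cosh r - Real.cosh ρ₀)) MeasureTheory.volume ρ₀ ρ :=
    Continuous.intervalIntegrable (by fun_prop) _ _
  refine (((hpow.const_mul (Real.sqrt (Real.sinh ρ₀))).add hroot).div_const
    (Real.sqrt (1 - 4*H^2))).mono_fun' ?_ ?_
  · exact Measurable.aestronglyMeasurable (by fun_prop)
  · rw [Set.uIoc_of_le hρ]
    filter_upwards [MeasureTheory.ae_restrict_mem measurableSet_Ioc] with r hr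
    exact abs_slope_le hH0 hH hρ₀ hc₂ hf hr.1

theorem eventually_le_slope {H d c₂ ρ₀ : ℝ} (hH0 : 0 < H) (hH : H < 1/2) (hρ₀ : 0 ≤ ρ₀)
    (hc₂ : c₂ ≤ 0)
    (hf : ∀ x : ℝ, x^2 - 1 - (d + 2*H*x)^2 = (1 - 4*H^2) * (x - Real.cosh ρ₀) * (x - c₂)) :
    ∀ᶠ r in Filter.atTop, H ≤
      (d + 2*H*Real.cosh r) / Real.sqrt (Real.sinh r ^ 2 - (d + 2*H*Real.cosh r)^2) := by
  have ha : 0 < 1 - 4*H^2 := by nlinarith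
  filter_upwards [Filter.eventually_gt_atTop ρ₀,
    Filter.eventually_ge_atTop (-d/H)] with r hr hd
  have hcr : r ≤ Real.cosh r :=
    (Real.self_le_sinh_iff.2 (by linarith)).trans (Real.sinh_lt_cosh r).le
  have hd' : -d ≤ H * Real.cosh r := by
    rw [div_le_iff₀ hH0] at hd
    nlinarith
  have hu : Real.cosh ρ₀ < Real.cosh r :=
    Real.cosh_lt_cosh.2 (by rwa [abs_of_nonneg hρ₀, abs_of_pos (by linarith)])
  have hpos : 0 < Real.sinh r ^ 2 - (d + 2*H*Real.cosh r)^2 := by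
    rw [Real.sinh_sq, hf]
    have := Real.cosh_pos r
    exact mul_pos (mul_pos ha (by linarith)) (by linarith)
  have hle : Real.sqrt (Real.sinh r ^ 2 - (d + 2*H*Real.cosh r)^2) ≤ Real.cosh r := by
    rw [Real.sqrt_le_left (Real.cosh_pos r).le, Real.sinh_sq]
    nlinarith [sq_nonneg (d + 2*H*Real.cosh r)]
  rw [le_div_iff₀ (Real.sqrt_pos.2 hpos)]
  nlinarith

theorem tendsto_integral_atTop_of_eventually_le {g : ℝ → ℝ} {a m : ℝ} (hm : 0 < m)
    (hint : ∀ b, a ≤ b → IntervalIntegrable g MeasureTheory.volume a b)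
    (hg : ∀ᶠ r in Filter.atTop, m ≤ g r) :
    Filter.Tendsto (fun b => ∫ r in a..b, g r) Filter.atTop Filter.atTop := by
  obtain ⟨R, haR, hR⟩ := ((Filter.eventually_ge_atTop a).and
    (Filter.eventually_forall_ge_atTop.2 hg)).exists
  refine Filter.tendsto_atTop_mono' _ (f₁ := fun b => (∫ r in a..R, g r) + m * (b - R)) ?_
    (Filter.tendsto_atTop_add_const_left _ _
      ((Filter.tendsto_atTop_add_const_right _ (-R) Filter.tendsto_id).const_mul_atTop hm))
  filter_upwards [Filter.eventually_ge_atTop R] with b hb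
  have hRb := (hint R haR).symm.trans (hint b (haR.trans hb))
  rw [← intervalIntegral.integral_add_adjacent_intervals (hint R haR) hRb]
  have := intervalIntegral.integral_mono_on hb intervalIntegrable_const hRb
    (fun r hr => hR r hr.1)
  rw [intervalIntegral.integral_const, smul_eq_mul] at this
  linarith

theorem stmt_5 (H d : ℝ) (hH0 : 0 < H) (hH : H < 1/2) :
    (∀ ρ : ℝ, arcosh ((2*d*H + Real.sqrt (1 - 4*H^2 + d^2))/(1 - 4*H^2)) < ρ →
      IntervalIntegrable
        (fun r => (d + 2*H*Real.cosh r) /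
          Real.sqrt (Real.sinh r ^ 2 - (d + 2*H*Real.cosh r)^2))
        MeasureTheory.volume
        (arcosh ((2*d*H + Real.sqrt (1 - 4*H^2 + d^2))/(1 - 4*H^2))) ρ) ∧
    Filter.Tendsto
      (fun ρ => ∫ r in (arcosh ((2*d*H + Real.sqrt (1 - 4*H^2 + d^2))/(1 - 4*H^2)))..ρ,
        (d + 2*H*Real.cosh r) /
          Real.sqrt (Real.sinh r ^ 2 - (d + 2*H*Real.cosh r)^2))
      Filter.atTop Filter.atTop := by
  obtain ⟨hc, c₂, hc₂, hf⟩ := sq_sub_one_sub_sq_factorization d hH0 hH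
  generalize (2*d*H + Real.sqrt (1 - 4*H^2 + d^2))/(1 - 4*H^2) = c at *
  have hρ₀ : 0 ≤ arcosh c := Real.arcosh_nonneg hc
  have hcosh : Real.cosh (arcosh c) = c := Real.cosh_arcosh hc
  rw [← hcosh] at hf
  have hint := fun ρ (hρ : arcosh c ≤ ρ) => intervalIntegrable_slope hH0 hH hρ₀ hc₂ hf hρ
  exact ⟨fun ρ hρ => hint ρ hρ.le,
    tendsto_integral_atTop_of_eventually_le hH0 hint (eventually_le_slope hH0 hH hρ₀ hc₂ hf)⟩
end

section
/- Let H > 1/2 and d < −√(4H² − 1), and for ρ ≥ 0 set f(ρ) = sinh²ρ − (d + 2H cosh ρ)². Set c₁ = (2dH + √(1 − 4H² + d²))/(1 − 4H²) and c₂ = (2dH − √(1 − 4H² + d²))/(1 − 4H²). Then 1 − 4H² + d² > 0, 1 ≤ c₁ < c₂, c₁ = 1 if and only if d = −2H, and for every ρ ≥ 0 one has f(ρ) > 0 if and only if c₁ < cosh ρ < c₂. -/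
theorem stmt_11 (H d : ℝ) (hH : 1/2 < H) (hd : d < -Real.sqrt (4*H^2 - 1)) :
    0 < 1 - 4*H^2 + d^2 ∧
    1 ≤ (2*d*H + Real.sqrt (1 - 4*H^2 + d^2))/(1 - 4*H^2) ∧
    (2*d*H + Real.sqrt (1 - 4*H^2 + d^2))/(1 - 4*H^2)
      < (2*d*H - Real.sqrt (1 - 4*H^2 + d^2))/(1 - 4*H^2) ∧
    ((2*d*H + Real.sqrt (1 - 4*H^2 + d^2))/(1 - 4*H^2) = 1 ↔ d = -2*H) ∧
    (∀ ρ : ℝ, 0 ≤ ρ →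
      (0 < Real.sinh ρ ^ 2 - (d + 2*H*Real.cosh ρ)^2 ↔
        (2*d*H + Real.sqrt (1 - 4*H^2 + d^2))/(1 - 4*H^2) < Real.cosh ρ ∧
        Real.cosh ρ < (2*d*H - Real.sqrt (1 - 4*H^2 + d^2))/(1 - 4*H^2))) := by
  have hA : 0 < 4*H^2 - 1 := by nlinarith
  have hr0 : 0 < Real.sqrt (4*H^2 - 1) := Real.sqrt_pos.mpr hA
  have hr2 : Real.sqrt (4*H^2 - 1) ^ 2 = 4*H^2 - 1 := Real.sq_sqrt hA.le
  set r := Real.sqrt (4*H^2 - 1)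
  have hdisc : 0 < 1 - 4*H^2 + d^2 := by nlinarith
  have hs0 : 0 < Real.sqrt (1 - 4*H^2 + d^2) := Real.sqrt_pos.mpr hdisc
  have hs2 : Real.sqrt (1 - 4*H^2 + d^2) ^ 2 = 1 - 4*H^2 + d^2 := Real.sq_sqrt hdisc.le
  set s := Real.sqrt (1 - 4*H^2 + d^2)
  have e₁ : (2*d*H + s)/(1 - 4*H^2) = (-(2*d*H) - s)/(4*H^2 - 1) := by
    rw [← neg_div_neg_eq]; ring_nf
  have e₂ : (2*d*H - s)/(1 - 4*H^2) = (-(2*d*H) + s)/(4*H^2 - 1) := by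
    rw [← neg_div_neg_eq]; ring_nf
  have hq : 0 < -(2*d*H) - (4*H^2 - 1) := by
    have hrH : r < 2*H := by nlinarith
    nlinarith [mul_pos (sub_pos.mpr hd) (show 0 < 2*H by linarith)]
  have hsq : (-(2*d*H) - (4*H^2 - 1))^2 = s^2 + (4*H^2 - 1) * (d + 2*H)^2 := by
    rw [hs2]; ring
  rw [e₁, e₂]
  refine ⟨hdisc, ?_, ?_, ?_, fun ρ _ => ?_⟩
  · rw [le_div_iff₀ hA]
    have : s ≤ -(2*d*H) - (4*H^2 - 1) :=
      by
      refine (pow_le_pow_iff_left₀ hs0.le hq.le two_ne_zero).mp ?_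
      rw [hsq]
      exact le_add_of_nonneg_right (mul_nonneg hA.le (sq_nonneg _))
    linarith
  · rw [div_lt_div_iff_of_pos_right hA]
    linarith
  · rw [div_eq_one_iff_eq hA.ne']
    constructor
    · intro h
      have hs : s = -(2*d*H) - (4*H^2 - 1) := by linarith
      have h0 : (4*H^2 - 1) * (d + 2*H)^2 = 0 := by rw [← hs] at hsq; linarith
      have h1 : d + 2*H = 0 := by simpa [hA.ne'] using h0
      linarith
    · intro h
      have h1 : d + 2*H = 0 := by linarith
      rw [h1] at hsq
      have : s = -(2*d*H) - (4*H^2 - 1) :=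
        (pow_left_inj₀ hs0.le hq.le two_ne_zero).mp (by linarith)
      linarith
  · rw [div_lt_iff₀ hA, lt_div_iff₀ hA, Real.sinh_sq]
    generalize Real.cosh ρ = x
    have key : (4*H^2 - 1) * (x^2 - 1 - (d + 2*H*x)^2)
        = s^2 - (x*(4*H^2 - 1) + 2*d*H)^2 := by rw [hs2]; ring
    rw [← mul_pos_iff_of_pos_left hA, key, sub_pos, sq_lt_sq, abs_of_pos hs0, abs_lt]
    constructor <;> rintro ⟨h1, h2⟩ <;> constructor <;> linarith
end

section
/- Let H > 1/2 and d < −2H, and set c₁ = (2dH + √(1 − 4H² + d²))/(1 − 4H²), c₂ = (2dH − √(1 − 4H² + d²))/(1 − 4H²). Then c₁ < −d/(2H) < c₂; moreover for ρ ≥ 0 with c₁ ≤ cosh ρ < −d/(2H) one has d + 2H cosh ρ < 0, and for −d/(2H) < cosh ρ ≤ c₂ one has d + 2H cosh ρ > 0. -/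
theorem stmt_13 (H d : ℝ) (hH : 1/2 < H) (hd : d < -2*H) :
    ((2*d*H + Real.sqrt (1 - 4*H^2 + d^2))/(1 - 4*H^2) < -d/(2*H) ∧
      -d/(2*H) < (2*d*H - Real.sqrt (1 - 4*H^2 + d^2))/(1 - 4*H^2)) ∧
    (∀ ρ : ℝ, 0 ≤ ρ →
      (2*d*H + Real.sqrt (1 - 4*H^2 + d^2))/(1 - 4*H^2) ≤ Real.cosh ρ →
      Real.cosh ρ < -d/(2*H) → d + 2*H*Real.cosh ρ < 0) ∧
    (∀ ρ : ℝ, 0 ≤ ρ → -d/(2*H) < Real.cosh ρ →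
      Real.cosh ρ ≤ (2*d*H - Real.sqrt (1 - 4*H^2 + d^2))/(1 - 4*H^2) →
      0 < d + 2*H*Real.cosh ρ) := by
  have hH0 : 0 < 2 * H := by linarith
  have hK : 1 - 4 * H ^ 2 < 0 := by nlinarith
  have hd2 : 4 * H ^ 2 < d ^ 2 := by nlinarith
  have hroot : -d < 2 * H * Real.sqrt (1 - 4 * H ^ 2 + d ^ 2) := by
    rw [← div_lt_iff₀' hH0]
    apply Real.lt_sqrt_of_sq_lt
    rw [div_pow, div_lt_iff₀ (by positivity)]
    nlinarith [mul_pos_of_neg_of_neg hK (sub_neg.mpr hd2)]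
  refine ⟨⟨?_, ?_⟩, fun ρ _ _ h => ?_, fun ρ _ h _ => ?_⟩
  · rw [div_lt_iff_of_neg hK, div_mul_eq_mul_div, div_lt_iff₀ hH0]
    nlinarith
  · rw [lt_div_iff_of_neg hK, div_mul_eq_mul_div, lt_div_iff₀ hH0]
    nlinarith
  · rw [lt_div_iff₀' hH0] at h
    linarith
  · rw [div_lt_iff₀' hH0] at h
    linarith
end

section
/- Let H > 1/2 and −2H < d < −√(4H² − 1), and set c₁ = (2dH + √(1 − 4H² + d²))/(1 − 4H²), c₂ = (2dH − √(1 − 4H² + d²))/(1 − 4H²). Then −d/(2H) < c₁; consequently d + 2H cosh ρ > 0 for every ρ ≥ 0 with c₁ ≤ cosh ρ ≤ c₂. -/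
theorem stmt_14 (H d : ℝ) (hH : 1/2 < H) (hd1 : -2*H < d)
    (hd2 : d < -Real.sqrt (4*H^2 - 1)) :
    -d/(2*H) < (2*d*H + Real.sqrt (1 - 4*H^2 + d^2))/(1 - 4*H^2) ∧
    ∀ ρ : ℝ, 0 ≤ ρ →
      (2*d*H + Real.sqrt (1 - 4*H^2 + d^2))/(1 - 4*H^2) ≤ Real.cosh ρ →
      Real.cosh ρ ≤ (2*d*H - Real.sqrt (1 - 4*H^2 + d^2))/(1 - 4*H^2) →
      0 < d + 2*H*Real.cosh ρ := by
  have hH0 : 0 < H := by linarith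
  have hK : 0 < 4*H^2 - 1 := by nlinarith
  have hd0 : d < 0 := by linarith [Real.sqrt_nonneg (4*H^2 - 1)]
  have hs : Real.sqrt (1 - 4*H^2 + d^2) < -d/(2*H) := by
    rw [Real.sqrt_lt' (div_pos (by linarith) (by linarith)), div_pow, lt_div_iff₀ (by positivity)]
    have hdH : 0 < 4*H^2 - d^2 := by nlinarith
    nlinarith [mul_pos hK hdH]
  rw [lt_div_iff₀ (by linarith)] at hs
  have key : -d/(2*H) < (2*d*H + Real.sqrt (1 - 4*H^2 + d^2))/(1 - 4*H^2) := by
    rw [← neg_div_neg_eq (2*d*H + _), div_lt_div_iff₀ (by linarith) (by linarith)]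
    linarith
  refine ⟨key, fun ρ _ h1 _ => ?_⟩
  have h := key.trans_le h1
  rw [div_lt_iff₀ (by linarith)] at h
  linarith
end

section
/- For d > 0 define h(d) = 2∫₀^∞ d/√((1 + d²)cosh²t − 1) dt. Then the integral converges for every d > 0, h is nondecreasing on (0, ∞), h(d) → 0 as d → 0⁺, and h(d) → π as d → +∞. -/
open Real Set Filter Topology MeasureTheory

theorem tendsto_sinh_atTop_atTop : Tendsto sinh atTop atTop :=
  tendsto_atTop_mono' _
    ((eventually_ge_atTop 0).mono fun _ ht => self_le_sinh_iff.2 ht) tendsto_id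

theorem hasDerivAt_arctan_sinh (t : ℝ) :
    HasDerivAt (fun t => arctan (sinh t)) (cosh t)⁻¹ t := by
  convert (hasDerivAt_sinh t).arctan using 1
  have := cosh_pos t
  rw [add_comm, ← cosh_sq]
  field_simp

theorem tendsto_arctan_sinh_atTop :
    Tendsto (fun t => arctan (sinh t)) atTop (𝓝 (π / 2)) :=
  (tendsto_nhds_of_tendsto_nhdsWithin tendsto_arctan_atTop).comp tendsto_sinh_atTop_atTop

theorem integrableOn_inv_cosh_Ioi : IntegrableOn (fun t => (cosh t)⁻¹) (Ioi 0) :=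
  integrableOn_Ioi_deriv_of_nonneg' (fun t _ => hasDerivAt_arctan_sinh t)
    (fun t _ => (inv_pos.2 (cosh_pos t)).le) tendsto_arctan_sinh_atTop

theorem integral_Ioi_inv_cosh : ∫ t in Ioi (0 : ℝ), (cosh t)⁻¹ = π / 2 := by
  rw [integral_Ioi_of_hasDerivAt_of_tendsto' (fun t _ => hasDerivAt_arctan_sinh t)
    integrableOn_inv_cosh_Ioi tendsto_arctan_sinh_atTop]
  simp

theorem catenoid_radicand_eq (d t : ℝ) :
    (1 + d ^ 2) * cosh t ^ 2 - 1 = d ^ 2 * cosh t ^ 2 + sinh t ^ 2 := by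
  rw [cosh_sq]
  ring

theorem catenoid_radicand_pos {d : ℝ} (hd : 0 < d) (t : ℝ) :
    0 < (1 + d ^ 2) * cosh t ^ 2 - 1 := by
  rw [catenoid_radicand_eq]
  have := cosh_pos t
  positivity

theorem catenoid_integrand_eq_inv {d : ℝ} (hd : 0 < d) (t : ℝ) :
    d / √((1 + d ^ 2) * cosh t ^ 2 - 1) = (√(cosh t ^ 2 + d⁻¹ ^ 2 * sinh t ^ 2))⁻¹ := by
  have h : (1 + d ^ 2) * cosh t ^ 2 - 1 = d ^ 2 * (cosh t ^ 2 + d⁻¹ ^ 2 * sinh t ^ 2) := by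
    rw [catenoid_radicand_eq]
    field_simp
  rw [h, sqrt_mul (sq_nonneg d), sqrt_sq hd.le, ← div_div, div_self hd.ne', one_div]

theorem catenoid_integrand_le_inv_cosh {d : ℝ} (hd : 0 < d) (t : ℝ) :
    d / √((1 + d ^ 2) * cosh t ^ 2 - 1) ≤ (cosh t)⁻¹ := by
  rw [catenoid_integrand_eq_inv hd]
  exact inv_anti₀ (cosh_pos t) (le_sqrt_of_sq_le (le_add_of_nonneg_right (by positivity)))

theorem catenoid_integrand_mono {d₁ d₂ : ℝ} (h₁ : 0 < d₁) (h : d₁ ≤ d₂) (t : ℝ) :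
    d₁ / √((1 + d₁ ^ 2) * cosh t ^ 2 - 1) ≤ d₂ / √((1 + d₂ ^ 2) * cosh t ^ 2 - 1) := by
  have h₂ := h₁.trans_le h
  have hc := cosh_pos t
  rw [catenoid_integrand_eq_inv h₁, catenoid_integrand_eq_inv h₂]
  gcongr

theorem norm_catenoid_integrand_le {d : ℝ} (hd : 0 < d) (t : ℝ) :
    ‖d / √((1 + d ^ 2) * cosh t ^ 2 - 1)‖ ≤ (cosh t)⁻¹ := by
  rw [norm_of_nonneg (by positivity)]
  exact catenoid_integrand_le_inv_cosh hd t

theorem continuous_catenoid_integrand {d : ℝ} (hd : 0 < d) :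
    Continuous fun t => d / √((1 + d ^ 2) * cosh t ^ 2 - 1) :=
  continuous_const.div (by fun_prop) fun t => (sqrt_pos.2 (catenoid_radicand_pos hd t)).ne'

theorem integrableOn_catenoid_integrand {d : ℝ} (hd : 0 < d) :
    IntegrableOn (fun t => d / √((1 + d ^ 2) * cosh t ^ 2 - 1)) (Ioi 0) :=
  integrableOn_inv_cosh_Ioi.mono' (continuous_catenoid_integrand hd).aestronglyMeasurable
    (ae_of_all _ (norm_catenoid_integrand_le hd))

theorem tendsto_integral_catenoid_integrand {l : Filter ℝ} [l.IsCountablyGenerated]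
    (hl : ∀ᶠ d in l, 0 < d) {f : ℝ → ℝ}
    (hf : ∀ t, 0 < t → Tendsto (fun d => d / √((1 + d ^ 2) * cosh t ^ 2 - 1)) l (𝓝 (f t))) :
    Tendsto (fun d => ∫ t in Ioi (0 : ℝ), d / √((1 + d ^ 2) * cosh t ^ 2 - 1)) l
      (𝓝 (∫ t in Ioi (0 : ℝ), f t)) :=
  tendsto_integral_filter_of_dominated_convergence (fun t => (cosh t)⁻¹)
    (hl.mono fun _ hd => (continuous_catenoid_integrand hd).aestronglyMeasurable)
    (hl.mono fun _ hd => ae_of_all _ (norm_catenoid_integrand_le hd))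
    integrableOn_inv_cosh_Ioi
    ((ae_restrict_iff' measurableSet_Ioi).2 (ae_of_all _ hf))

theorem tendsto_catenoid_integrand_zero {t : ℝ} (ht : 0 < t) :
    Tendsto (fun d => d / √((1 + d ^ 2) * cosh t ^ 2 - 1)) (𝓝[>] 0) (𝓝 0) := by
  have hs := sinh_pos_iff.2 ht
  have hc : ContinuousAt (fun d => d / √((1 + d ^ 2) * cosh t ^ 2 - 1)) 0 := by
    refine continuousAt_id.div (by fun_prop) ?_
    rw [catenoid_radicand_eq]
    positivity
  simpa using hc.tendsto.mono_left nhdsWithin_le_nhds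

theorem tendsto_catenoid_integrand_atTop (t : ℝ) :
    Tendsto (fun d => d / √((1 + d ^ 2) * cosh t ^ 2 - 1)) atTop (𝓝 (cosh t)⁻¹) := by
  have hpos := cosh_pos t
  have hc : ContinuousAt (fun u => (√(cosh t ^ 2 + u ^ 2 * sinh t ^ 2))⁻¹) 0 := by
    refine ContinuousAt.inv₀ (by fun_prop) ?_
    positivity
  have h := hc.tendsto.comp (tendsto_inv_atTop_zero (𝕜 := ℝ))
  simp only [ne_eq, OfNat.ofNat_ne_zero, not_false_eq_true, zero_pow, zero_mul, add_zero,
    sqrt_sq hpos.le] at h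
  exact h.congr' ((eventually_gt_atTop 0).mono fun d hd => (catenoid_integrand_eq_inv hd t).symm)


theorem stmt_19 :
    (∀ d : ℝ, 0 < d →
      MeasureTheory.IntegrableOn
        (fun t => d / Real.sqrt ((1 + d^2) * Real.cosh t ^ 2 - 1))
        (Set.Ioi (0:ℝ)) MeasureTheory.volume) ∧
    (∀ d₁ d₂ : ℝ, 0 < d₁ → d₁ ≤ d₂ →
      2 * ∫ t in Set.Ioi (0:ℝ), d₁ / Real.sqrt ((1 + d₁^2) * Real.cosh t ^ 2 - 1) ≤
      2 * ∫ t in Set.Ioi (0:ℝ), d₂ / Real.sqrt ((1 + d₂^2) * Real.cosh t ^ 2 - 1)) ∧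
    Filter.Tendsto
      (fun d : ℝ => 2 * ∫ t in Set.Ioi (0:ℝ), d / Real.sqrt ((1 + d^2) * Real.cosh t ^ 2 - 1))
      (nhdsWithin 0 (Set.Ioi (0:ℝ))) (nhds 0) ∧
    Filter.Tendsto
      (fun d : ℝ => 2 * ∫ t in Set.Ioi (0:ℝ), d / Real.sqrt ((1 + d^2) * Real.cosh t ^ 2 - 1))
      Filter.atTop (nhds Real.pi) := by
  refine ⟨fun d hd => integrableOn_catenoid_integrand hd, fun d₁ d₂ h₁ h => ?_, ?_, ?_⟩
  · exact mul_le_mul_of_nonneg_left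
      (setIntegral_mono (integrableOn_catenoid_integrand h₁)
        (integrableOn_catenoid_integrand (h₁.trans_le h)) (catenoid_integrand_mono h₁ h))
      zero_le_two
  · simpa using (tendsto_integral_catenoid_integrand (l := 𝓝[>] 0) self_mem_nhdsWithin
      fun t ht => tendsto_catenoid_integrand_zero ht).const_mul 2
  · have h := (tendsto_integral_catenoid_integrand (eventually_gt_atTop 0)
      fun t _ => tendsto_catenoid_integrand_atTop t).const_mul 2
    rwa [integral_Ioi_inv_cosh, mul_div_cancel₀ π two_ne_zero] at h
end
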